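/- Let f(n) = a n² + 2a n + c with a, c ∈ ℤ, a odd, c odd, and suppose 4a² − 4ac = 4^ℓ · Δ with ℓ ≥ 2 an integer and Δ an integer whose residue m = Δ mod 8 lies in {2, 3, 5, 6, 7}. Then f(n) ≠ 0 for all n ∈ ℕ and: (i) if n ≡ 0 (mod 2) then ν₂(f(n)) = 0; (ii) if 2 ≤ i < ℓ and n ≡ 2^{i−1} − 1 (mod 2^i) then ν₂(f(n)) = 2(i−1); (iii) if n ≡ 2^{ℓ−1} − 1 (mod 2^ℓ) then ν₂(f(n)) = 2(ℓ−1) when m ∈ {2, 6}, ν₂(f(n)) = 2ℓ − 1 when m ∈ {3, 7}, and ν₂(f(n)) = 2ℓ when m = 5; (iv) if n ≡ 2^ℓ − 1 (mod 2^ℓ) then ν₂(f(n)) = 2ℓ − 1 when m ∈ {2, 6} and ν₂(f(n)) = 2(ℓ−1) when m ∈ {3, 5, 7}. -/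

import Mathlib

/-- If `a * x = 2 ^ k * q` with `a` and `q` odd, then the 2-adic valuation of `x` is `k`. -/
theorem padicValInt_two_eq_of_odd_mul_eq {a x q : ℤ} {k : ℕ} (ha : Odd a) (hq : Odd q)
    (h : a * x = 2 ^ k * q) : padicValInt 2 x = k := by
  have val_odd {z : ℤ} (hz : Odd z) : padicValInt 2 z = 0 :=
    padicValInt.eq_zero_of_not_dvd fun hd =>
      Int.not_even_iff_odd.mpr hz (even_iff_two_dvd.mpr hd)
  have ne_zero {z : ℤ} (hz : Odd z) : z ≠ 0 := by
    rintro rfl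
    simp at hz
  have hx : x ≠ 0 := by
    rintro rfl
    rw [mul_zero] at h
    exact mul_ne_zero (pow_ne_zero k two_ne_zero) (ne_zero hq) h.symm
  have hval := congrArg (padicValInt 2) h
  have hpow : padicValInt 2 ((2 : ℤ) ^ k) = k := by
    have : ((2 : ℤ) ^ k) = ((2 ^ k : ℕ) : ℤ) := by push_cast; rfl
    rw [this, padicValInt.of_nat, padicValNat.prime_pow]
  rw [padicValInt.mul (ne_zero ha) hx,
    padicValInt.mul (pow_ne_zero k two_ne_zero) (ne_zero hq), val_odd ha, val_odd hq, hpow] at hval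
  omega

/-- A square is congruent to `0`, `1` or `4` modulo `8`. -/
theorem Int.sq_emod_eight (k : ℤ) : k ^ 2 % 8 = 0 ∨ k ^ 2 % 8 = 1 ∨ k ^ 2 % 8 = 4 := by
  have h : k % 8 = 0 ∨ k % 8 = 1 ∨ k % 8 = 2 ∨ k % 8 = 3 ∨ k % 8 = 4 ∨ k % 8 = 5 ∨
      k % 8 = 6 ∨ k % 8 = 7 := by omega
  rcases h with h | h | h | h | h | h | h | h <;> simp [pow_two, Int.mul_emod, h]


/-- Type `(ℓ, 1)` trees: complete description of the 2-adic valuations of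
`f(n) = a n² + 2a n + c` with `a, c` odd and `4a² − 4ac = 4^ℓ Δ`,
`m = Δ mod 8 ∈ {2,3,5,6,7}`, `ℓ ≥ 2`. -/
theorem stmt_19 (a c : ℤ) (ha : Odd a) (hc : Odd c) (ℓ : ℕ) (hℓ : 2 ≤ ℓ) (Δ : ℤ)
    (hdisc : 4 * a ^ 2 - 4 * a * c = 4 ^ ℓ * Δ) (m : ℤ) (hm : m = Δ % 8)
    (hmem : m = 2 ∨ m = 3 ∨ m = 5 ∨ m = 6 ∨ m = 7) :
    ∀ n : ℕ,
      (a * (n : ℤ) ^ 2 + 2 * a * (n : ℤ) + c ≠ 0) ∧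
      ((n : ℤ) ≡ 0 [ZMOD 2] →
        padicValInt 2 (a * (n : ℤ) ^ 2 + 2 * a * (n : ℤ) + c) = 0) ∧
      (∀ i : ℕ, 2 ≤ i → i < ℓ →
        (n : ℤ) ≡ 2 ^ (i - 1) - 1 [ZMOD (2 ^ i : ℕ)] →
        padicValInt 2 (a * (n : ℤ) ^ 2 + 2 * a * (n : ℤ) + c) = 2 * (i - 1)) ∧
      ((n : ℤ) ≡ 2 ^ (ℓ - 1) - 1 [ZMOD (2 ^ ℓ : ℕ)] →
        ((m = 2 ∨ m = 6) →
          padicValInt 2 (a * (n : ℤ) ^ 2 + 2 * a * (n : ℤ) + c) = 2 * (ℓ - 1)) ∧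
        ((m = 3 ∨ m = 7) →
          padicValInt 2 (a * (n : ℤ) ^ 2 + 2 * a * (n : ℤ) + c) = 2 * ℓ - 1) ∧
        (m = 5 →
          padicValInt 2 (a * (n : ℤ) ^ 2 + 2 * a * (n : ℤ) + c) = 2 * ℓ)) ∧
      ((n : ℤ) ≡ 2 ^ ℓ - 1 [ZMOD (2 ^ ℓ : ℕ)] →
        ((m = 2 ∨ m = 6) →
          padicValInt 2 (a * (n : ℤ) ^ 2 + 2 * a * (n : ℤ) + c) = 2 * ℓ - 1) ∧
        ((m = 3 ∨ m = 5 ∨ m = 7) →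
          padicValInt 2 (a * (n : ℤ) ^ 2 + 2 * a * (n : ℤ) + c) = 2 * (ℓ - 1))) := by
  intro n
  obtain ⟨r, rfl⟩ : ∃ r, ℓ = r + 1 := ⟨ℓ - 1, by omega⟩
  have key : a * (a * (n : ℤ) ^ 2 + 2 * a * (n : ℤ) + c) =
      (a * ((n : ℤ) + 1)) ^ 2 - (2 ^ r) ^ 2 * Δ := by
    have h4 : (4 : ℤ) ^ (r + 1) = 4 * (2 ^ r) ^ 2 := by
      rw [← pow_mul, mul_comm r 2, pow_mul, pow_succ]
      norm_num [mul_comm]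
    rw [h4] at hdisc
    linarith
  set F := a * (n : ℤ) ^ 2 + 2 * a * (n : ℤ) + c
  -- The node `n ≡ 2 ^ j - 1` modulo `2 ^ (j + 1)`.
  have node (j : ℕ) (h : (n : ℤ) ≡ 2 ^ j - 1 [ZMOD (2 ^ (j + 1) : ℕ)]) :
      ∃ k, Odd k ∧ a * ((n : ℤ) + 1) = 2 ^ j * k := by
    obtain ⟨t, ht⟩ := h.symm.dvd
    refine ⟨a * (2 * t + 1), ha.mul ⟨t, rfl⟩, ?_⟩
    push_cast at ht
    rw [show (n : ℤ) = 2 ^ j - 1 + 2 ^ (j + 1) * t by linarith]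
    ring
  refine ⟨?_, ?_, ?_, ?_, ?_⟩
  · intro h0
    rw [h0, mul_zero] at key
    have hdvd : (2 ^ r : ℤ) ∣ a * ((n : ℤ) + 1) :=
      (Int.pow_dvd_pow_iff two_ne_zero).mp ⟨Δ, by linarith⟩
    obtain ⟨k, hk⟩ := hdvd
    have hkΔ : k ^ 2 = Δ := by
      have hpos : ((2 : ℤ) ^ r) ^ 2 ≠ 0 := by positivity
      apply mul_left_cancel₀ hpos
      rw [← mul_pow, ← hk]
      linarith
    have := Int.sq_emod_eight k
    rw [hkΔ] at this
    omega
  · intro h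
    obtain ⟨k, hk, hy⟩ := node 0 (by
      have := h
      simp only [Int.ModEq] at this ⊢
      norm_num
      omega)
    refine padicValInt_two_eq_of_odd_mul_eq (k := 0) ha
      (q := k ^ 2 - (2 ^ r) ^ 2 * Δ) (hk.pow.sub_even ?_) (by rw [key, hy]; ring)
    have : Even ((2 : ℤ) ^ r) := even_two.pow_of_ne_zero (by omega)
    exact (this.pow_of_ne_zero two_ne_zero).mul_right _
  · intro i hi hil h
    obtain ⟨j, rfl⟩ : ∃ j, i = j + 1 := ⟨i - 1, by omega⟩
    obtain ⟨d, rfl⟩ : ∃ d, r = j + (d + 1) := ⟨r - j - 1, by omega⟩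
    obtain ⟨k, hk, hy⟩ := node j h
    refine padicValInt_two_eq_of_odd_mul_eq ha
      (q := k ^ 2 - (2 ^ (d + 1)) ^ 2 * Δ) (hk.pow.sub_even ?_) ?_
    · have : Even ((2 : ℤ) ^ (d + 1)) := even_two.pow_of_ne_zero (by omega)
      exact (this.pow_of_ne_zero two_ne_zero).mul_right _
    · rw [key, hy, Nat.add_sub_cancel]
      ring
  · intro h
    obtain ⟨k, hk, hy⟩ := node r h
    have hk8 : k ^ 2 % 8 = 1 := by
      have hodd : k ^ 2 % 2 = 1 := Int.odd_iff.mp hk.pow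
      have := Int.sq_emod_eight k
      omega
    have hF : a * F = 2 ^ (2 * r) * (k ^ 2 - Δ) := by
      rw [key, hy]
      ring
    refine ⟨fun hm' => ?_, fun hm' => ?_, fun hm' => ?_⟩
    · exact padicValInt_two_eq_of_odd_mul_eq ha (Int.odd_iff.mpr (by omega)) hF
    · obtain ⟨q, hq⟩ : ∃ q, k ^ 2 - Δ = 2 * q := ⟨(k ^ 2 - Δ) / 2, by omega⟩
      rw [show 2 * (r + 1) - 1 = 2 * r + 1 by omega]
      exact padicValInt_two_eq_of_odd_mul_eq ha (q := q) (Int.odd_iff.mpr (by omega))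
        (by rw [hF, hq]; ring)
    · obtain ⟨q, hq⟩ : ∃ q, k ^ 2 - Δ = 4 * q := ⟨(k ^ 2 - Δ) / 4, by omega⟩
      exact padicValInt_two_eq_of_odd_mul_eq ha (q := q) (Int.odd_iff.mpr (by omega))
        (by rw [hF, hq]; ring)
  · intro h
    obtain ⟨t, ht⟩ := h.symm.dvd
    push_cast at ht
    have hF : a * F = 2 ^ (2 * r) * (4 * (a * (t + 1)) ^ 2 - Δ) := by
      rw [key, show (n : ℤ) = 2 ^ (r + 1) - 1 + 2 ^ (r + 1) * t by linarith]
      ring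
    refine ⟨fun hm' => ?_, fun hm' => ?_⟩
    · rw [show 2 * (r + 1) - 1 = 2 * r + 1 by omega]
      obtain ⟨q, hq⟩ : ∃ q, Δ = 2 * q := ⟨Δ / 2, by omega⟩
      exact padicValInt_two_eq_of_odd_mul_eq ha (q := 2 * (a * (t + 1)) ^ 2 - q)
        (Int.odd_iff.mpr (by omega)) (by rw [hF, hq]; ring)
    · exact padicValInt_two_eq_of_odd_mul_eq ha (Int.odd_iff.mpr (by omega)) hF
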